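/- Let m ≥ 1 with gcd(m, 6) = 1 and let π = (ℤ/mℤ) × O*, where O* is the binary octahedral group of order 48. Then dim_ℂ 𝒜_Θ^odd(ℂπ) = (34/3)m² + 12m + 35/3 and dim_ℂ 𝒜_Θ^odd(Ker ε) = (34/3)m² + 8m + 23/3. In particular, for m = 1 (π = O*), dim_ℂ 𝒜_Θ^odd(ℂπ) = 35 and dim_ℂ 𝒜_Θ^odd(Ker ε) = 27. -/

import Mathlib

/-!
Statement 7: dimensions of `𝒜_Θ^odd(ℂπ)` and `𝒜_Θ^odd(Ker ε)` for
`π = (ℤ/mℤ) × O*`, where `O*` is the binary octahedral group of order 48, the group with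
presentation `⟨a, b ∣ (ab)² = a³ = b⁴⟩`.

Identifying `(ℂπ)^{⊗3}` with functions `π³ → ℂ`, `dim 𝒜_Θ^odd(ℂπ)` (resp.
`dim 𝒜_Θ^odd(Ker ε)`) is the dimension of the space of functions `π³ → ℂ`
(resp. of such functions with vanishing marginal sums, cutting out `(Ker ε)^{⊗3}`)
invariant under permutations of the coordinates, the two-sided action
`(x,y,z) ↦ (gxh⁻¹,gyh⁻¹,gzh⁻¹)` and coordinatewise inversion.
-/

open scoped BigOperators

/-- The dimension `dim_ℂ 𝒜_Θ^odd(ℂπ)`. -/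
noncomputable def dimAThetaOddGroupAlgebra (G : Type*) [Group G] : ℕ :=
  Module.finrank ℂ ↥(Submodule.span ℂ
    { f : G × G × G → ℂ |
      (∀ x y z : G, f (y, x, z) = f (x, y, z)) ∧
      (∀ x y z : G, f (x, z, y) = f (x, y, z)) ∧
      (∀ g h x y z : G, f (g * x * h⁻¹, g * y * h⁻¹, g * z * h⁻¹) = f (x, y, z)) ∧
      (∀ x y z : G, f (x⁻¹, y⁻¹, z⁻¹) = f (x, y, z)) })

/-- The dimension `dim_ℂ 𝒜_Θ^odd(Ker ε)`. -/
noncomputable def dimAThetaOddKerAug (G : Type*) [Group G] : ℕ :=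
  Module.finrank ℂ ↥(Submodule.span ℂ
    { f : G × G × G → ℂ |
      (∀ x y z : G, f (y, x, z) = f (x, y, z)) ∧
      (∀ x y z : G, f (x, z, y) = f (x, y, z)) ∧
      (∀ g h x y z : G, f (g * x * h⁻¹, g * y * h⁻¹, g * z * h⁻¹) = f (x, y, z)) ∧
      (∀ x y z : G, f (x⁻¹, y⁻¹, z⁻¹) = f (x, y, z)) ∧
      (∀ y z : G, ∑ᶠ x : G, f (x, y, z) = 0) ∧
      (∀ x z : G, ∑ᶠ y : G, f (x, y, z) = 0) ∧
      (∀ x y : G, ∑ᶠ z : G, f (x, y, z) = 0) })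

/-- The binary octahedral group `O*` of order 48, with presentation
`⟨a, b ∣ (ab)² = a³ = b⁴⟩` (the two relators `(ab)²a⁻³` and `a³b⁻⁴`). -/
abbrev binaryOctahedralGroup : Type :=
  PresentedGroup
    ({(FreeGroup.of 0 * FreeGroup.of 1)^2 * (FreeGroup.of 0 ^ 3)⁻¹,
      FreeGroup.of 0 ^ 3 * (FreeGroup.of 1 ^ 4)⁻¹} : Set (FreeGroup (Fin 2)))

open Module

theorem card_mul_finrank_eq_card_fixed {E X : Type*} [Fintype E] [Nonempty E] [Fintype X]
    (φ : E → X → X) (S : Submodule ℂ (X → ℂ))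
    (hfix : ∀ f ∈ S, ∀ e x, f (φ e x) = f x)
    (hsum : ∀ f : X → ℂ, (fun x => ∑ e, f (φ e x)) ∈ S) :
    Nat.card E * finrank ℂ S = Nat.card {p : E × X // φ p.1 p.2 = p.2} := by
  classical
  have hE : (Fintype.card E : ℂ) ≠ 0 := Nat.cast_ne_zero.2 Fintype.card_ne_zero
  let P : (X → ℂ) →ₗ[ℂ] (X → ℂ) :=
    (Fintype.card E : ℂ)⁻¹ • ∑ e, LinearMap.funLeft ℂ ℂ (φ e)
  have hP : LinearMap.IsProj S P := by
    constructor
    · intro f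
      have := S.smul_mem (Fintype.card E : ℂ)⁻¹ (hsum f)
      convert this using 1
      ext x
      simp [P, LinearMap.funLeft_apply]
    · intro f hf
      ext x
      simp [P, LinearMap.funLeft_apply, hfix f hf, hE]
  have htr (e : E) : LinearMap.trace ℂ (X → ℂ) (LinearMap.funLeft ℂ ℂ (φ e))
      = ∑ x, if φ e x = x then (1 : ℂ) else 0 := by
    rw [LinearMap.trace_eq_matrix_trace ℂ (Pi.basisFun ℂ X), Matrix.trace]
    simp [LinearMap.funLeft_apply, Pi.single_apply]
  have h := hP.trace
  simp only [P, map_smul, map_sum, htr, smul_eq_mul] at h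
  rw [inv_mul_eq_iff_eq_mul₀ hE] at h
  have hcard : Nat.card {p : E × X // φ p.1 p.2 = p.2}
      = ∑ e, ∑ x, if φ e x = x then 1 else 0 := by
    rw [Nat.card_eq_fintype_card, Fintype.card_subtype, Finset.card_filter,
      Fintype.sum_prod_type]
  rw [hcard, Nat.card_eq_fintype_card]
  exact_mod_cast h.symm

section fixedPointCounts

variable {Γ X Y : Type*}

theorem card_subtype_prod_eq_sum [Fintype Γ] [Finite X] (P : Γ → X → Prop) :
    Nat.card {p : Γ × X // P p.1 p.2} = ∑ c, Nat.card {x // P c x} := by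
  rw [← Nat.card_sigma]
  exact Nat.card_congr
    { toFun := fun p => ⟨p.1.1, p.1.2, p.2⟩
      invFun := fun p => ⟨(p.1, p.2.1), p.2.2⟩
      left_inv := fun _ => rfl
      right_inv := fun _ => rfl }

theorem card_subtype_and (P : X → Prop) (Q : Y → Prop) :
    Nat.card {p : X × Y // P p.1 ∧ Q p.2} = Nat.card {x // P x} * Nat.card {y // Q y} := by
  rw [← Nat.card_prod]
  exact Nat.card_congr Equiv.subtypeProdEquivProd

theorem card_subtype_eq_card_mul_of_equiv {G Z W : Type*} (e : G × W ≃ Z) (P : Z → Prop)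
    (Q : W → Prop) (h : ∀ g w, P (e (g, w)) ↔ Q w) :
    Nat.card {z // P z} = Nat.card G * Nat.card {w // Q w} := by
  rw [← Nat.card_congr (Equiv.subtypeUnivEquiv (p := fun _ : G => True) fun _ => trivial),
    ← card_subtype_and]
  exact (Nat.card_congr (e.subtypeEquiv fun q => by rw [h, true_and])).symm

/-- The six permutations of the coordinates of a triple. -/
def permTriple (i : Fin 6) (p : X × X × X) : X × X × X :=
  ![(p.1, p.2.1, p.2.2), (p.2.1, p.1, p.2.2), (p.1, p.2.2, p.2.1), (p.2.2, p.2.1, p.1),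
    (p.2.1, p.2.2, p.1), (p.2.2, p.1, p.2.1)] i

/-- The two permutations of the coordinates of a pair. -/
def permPair (i : Fin 2) (p : X × X) : X × X := ![(p.1, p.2), (p.2, p.1)] i

theorem card_fixed_swap (T : X → X) :
    Nat.card {p : X × X // T p.2 = p.1 ∧ T p.1 = p.2} = Nat.card {x // T (T x) = x} :=
  Nat.card_congr
    { toFun := fun p => ⟨p.1.1, by rw [p.2.2, p.2.1]⟩
      invFun := fun x => ⟨(x.1, T x.1), x.2, rfl⟩
      left_inv := fun p => by ext <;> simp [p.2.2]
      right_inv := fun _ => rfl }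

theorem sum_card_fixed_permTriple (T : X → X) :
    ∑ i : Fin 6, Nat.card {p : X × X × X // permTriple i (T p.1, T p.2.1, T p.2.2) = p}
      = Nat.card {p : X × X × X // T p.1 = p.1 ∧ T p.2.1 = p.2.1 ∧ T p.2.2 = p.2.2}
        + 3 * Nat.card {p : X × X // T (T p.1) = p.1 ∧ T p.2 = p.2}
        + 2 * Nat.card {x // T (T (T x)) = x} := by
  have h1 : Nat.card {p : X × X × X // permTriple 1 (T p.1, T p.2.1, T p.2.2) = p}
      = Nat.card {p : X × X // T (T p.1) = p.1 ∧ T p.2 = p.2} := Nat.card_congr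
    { toFun := fun p => ⟨(p.1.1, p.1.2.2), by
        obtain ⟨⟨x, y, z⟩, h⟩ := p
        simp [permTriple] at h ⊢
        obtain ⟨h1, h2, h3⟩ := h
        simp [h1, h2, h3]⟩
      invFun := fun p => ⟨(p.1.1, T p.1.1, p.1.2), by simp [permTriple, p.2.1, p.2.2]⟩
      left_inv := fun ⟨⟨x, y, z⟩, h⟩ => by
        have h' := h
        simp [permTriple] at h'
        simp [h'.2.1]
      right_inv := fun _ => rfl }
  have h2 : Nat.card {p : X × X × X // permTriple 2 (T p.1, T p.2.1, T p.2.2) = p}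
      = Nat.card {p : X × X // T (T p.1) = p.1 ∧ T p.2 = p.2} := Nat.card_congr
    { toFun := fun p => ⟨(p.1.2.1, p.1.1), by
        obtain ⟨⟨x, y, z⟩, h⟩ := p
        simp [permTriple] at h ⊢
        obtain ⟨h1, h2, h3⟩ := h
        simp [h1, h2, h3]⟩
      invFun := fun p => ⟨(p.1.2, p.1.1, T p.1.1), by simp [permTriple, p.2.1, p.2.2]⟩
      left_inv := fun ⟨⟨x, y, z⟩, h⟩ => by
        have h' := h
        simp [permTriple] at h'
        simp [h'.2.2]
      right_inv := fun _ => rfl }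
  have h3 : Nat.card {p : X × X × X // permTriple 3 (T p.1, T p.2.1, T p.2.2) = p}
      = Nat.card {p : X × X // T (T p.1) = p.1 ∧ T p.2 = p.2} := Nat.card_congr
    { toFun := fun p => ⟨(p.1.1, p.1.2.1), by
        obtain ⟨⟨x, y, z⟩, h⟩ := p
        simp [permTriple] at h ⊢
        obtain ⟨h1, h2, h3⟩ := h
        simp [h1, h2, h3]⟩
      invFun := fun p => ⟨(p.1.1, p.1.2, T p.1.1), by simp [permTriple, p.2.1, p.2.2]⟩
      left_inv := fun ⟨⟨x, y, z⟩, h⟩ => by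
        have h' := h
        simp [permTriple] at h'
        simp [h'.2.2]
      right_inv := fun _ => rfl }
  have h4 : Nat.card {p : X × X × X // permTriple 4 (T p.1, T p.2.1, T p.2.2) = p}
      = Nat.card {x // T (T (T x)) = x} := Nat.card_congr
    { toFun := fun p => ⟨p.1.1, by
        obtain ⟨⟨x, y, z⟩, h⟩ := p
        simp [permTriple] at h ⊢
        obtain ⟨h1, h2, h3⟩ := h
        simp [h1, h2, h3]⟩
      invFun := fun x => ⟨(x.1, T (T x.1), T x.1), by simp [permTriple, x.2]⟩
      left_inv := fun ⟨⟨x, y, z⟩, h⟩ => by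
        have h' := h
        simp [permTriple] at h'
        simp [h'.2.1, h'.2.2]
      right_inv := fun _ => rfl }
  have h5 : Nat.card {p : X × X × X // permTriple 5 (T p.1, T p.2.1, T p.2.2) = p}
      = Nat.card {x // T (T (T x)) = x} := Nat.card_congr
    { toFun := fun p => ⟨p.1.1, by
        obtain ⟨⟨x, y, z⟩, h⟩ := p
        simp [permTriple] at h ⊢
        obtain ⟨h1, h2, h3⟩ := h
        simp [h1, h2, h3]⟩
      invFun := fun x => ⟨(x.1, T x.1, T (T x.1)), by simp [permTriple, x.2]⟩
      left_inv := fun ⟨⟨x, y, z⟩, h⟩ => by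
        have h' := h
        simp [permTriple] at h'
        simp [h'.2.1, h'.2.2]
      right_inv := fun _ => rfl }
  rw [Fin.sum_univ_six, h1, h2, h3, h4, h5]
  simp only [permTriple, Matrix.cons_val_zero, Prod.ext_iff]
  ring

theorem sum_card_fixed_permPair (T : X → X) :
    ∑ i : Fin 2, Nat.card {p : X × X // permPair i (T p.1, T p.2) = p}
      = Nat.card {p : X × X // T p.1 = p.1 ∧ T p.2 = p.2} + Nat.card {x // T (T x) = x} := by
  rw [Fin.sum_univ_two, ← card_fixed_swap]
  simp only [permPair, Matrix.cons_val_zero, Matrix.cons_val_one, Prod.ext_iff]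

end fixedPointCounts

section relCount

variable {X Y : Type*} [Fintype X] [Fintype Y]

/-- The sum over `x` of the `k`-th powers of the numbers of elements related to `x`. -/
noncomputable def relCount (k : ℕ) (R : X → X → Prop) : ℕ :=
  ∑ x, Nat.card {y // R x y} ^ k

theorem card_related_pairs (R : X → X → Prop) :
    Nat.card {p : X × X // R p.1 p.2} = relCount 1 R := by
  simp only [relCount, pow_one, card_subtype_prod_eq_sum]

theorem card_related_triples (R : X → X → Prop) :
    Nat.card {p : X × X × X // R p.1 p.2.1 ∧ R p.1 p.2.2} = relCount 2 R := by
  rw [card_subtype_prod_eq_sum (fun x (q : X × X) => R x q.1 ∧ R x q.2), relCount]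
  exact Finset.sum_congr rfl fun x _ => by rw [card_subtype_and, pow_two]

theorem relCount_prod (k : ℕ) (R : X × Y → X × Y → Prop) (RX : X → X → Prop)
    (RY : Y → Y → Prop) (h : ∀ p q, R p q ↔ RX p.1 q.1 ∧ RY p.2 q.2) :
    relCount k R = relCount k RX * relCount k RY := by
  simp only [relCount, h, card_subtype_and, mul_pow, Fintype.sum_prod_type, Finset.sum_mul_sum]

theorem relCount_congr (k : ℕ) (e : X ≃ Y) (RX : X → X → Prop) (RY : Y → Y → Prop)
    (h : ∀ p q, RX p q ↔ RY (e p) (e q)) : relCount k RX = relCount k RY :=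
  Fintype.sum_equiv e _ _ fun x => by
    rw [Nat.card_congr (e.subtypeEquiv (h x))]

theorem relCount_of_card_eq (k c : ℕ) (R : X → X → Prop)
    (h : ∀ x, Nat.card {y // R x y} = c) : relCount k R = Nat.card X * c ^ k := by
  simp [relCount, h]

end relCount

section CommGroup

variable {A : Type*} [CommGroup A] [Fintype A]

theorem relCount_commute_of_comm (k : ℕ) :
    relCount k (Commute : A → A → Prop) = Nat.card A * Nat.card A ^ k :=
  relCount_of_card_eq _ _ _ fun x => by
    simp only [Commute.all x]
    exact Nat.card_congr (Equiv.subtypeUnivEquiv fun _ => trivial)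

theorem relCount_sq_commute_of_comm (k : ℕ) :
    relCount k (fun x y : A => Commute (x ^ 2) y) = Nat.card A * Nat.card A ^ k :=
  relCount_of_card_eq _ _ _ fun x => by
    simp only [Commute.all (x ^ 2)]
    exact Nat.card_congr (Equiv.subtypeUnivEquiv fun _ => trivial)

theorem relCount_pow_eq_pow_of_coprime (k i j : ℕ) (h : (Nat.card A).Coprime j) :
    relCount k (fun x y : A => x ^ i = y ^ j) = Nat.card A := by
  rw [relCount_of_card_eq k 1, one_pow, mul_one]
  intro x
  obtain ⟨y, hy⟩ := (powCoprime h).surjective (x ^ i)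
  rw [Nat.card_eq_one_iff_unique]
  refine ⟨⟨fun u v => Subtype.ext ((powCoprime h).injective ?_)⟩, ⟨y, hy.symm⟩⟩
  exact u.2.symm.trans v.2

end CommGroup

section twistedAction

variable {G : Type*} [Group G]

/-- The two-sided translation of `x` by a pair, preceded by inversion if `c.1` is true. -/
def twist (c : Bool × G × G) (x : G) : G :=
  c.2.1 * (bif c.1 then x⁻¹ else x) * c.2.2⁻¹

variable (G) [Fintype G]

theorem sum_twist_false_card_fixed_triple :
    ∑ c : G × G, Nat.card {p : G × G × G // twist (false, c) p.1 = p.1 ∧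
        twist (false, c) p.2.1 = p.2.1 ∧ twist (false, c) p.2.2 = p.2.2}
      = Nat.card G * relCount 2 (Commute : G → G → Prop) := by
  rw [← card_subtype_prod_eq_sum fun (c : G × G) (p : G × G × G) => twist (false, c) p.1 = p.1 ∧
        twist (false, c) p.2.1 = p.2.1 ∧ twist (false, c) p.2.2 = p.2.2,
    ← card_related_triples, ← Nat.card_prod]
  refine Nat.card_congr
    { toFun := fun q => (q.1.2.1,
        ⟨(q.1.1.2, q.1.2.1⁻¹ * q.1.2.2.1, q.1.2.1⁻¹ * q.1.2.2.2), ?_⟩)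
      invFun := fun q => ⟨((q.1 * q.2.1.1 * q.1⁻¹, q.2.1.1),
        (q.1, q.1 * q.2.1.2.1, q.1 * q.2.1.2.2)), ?_⟩
      left_inv := ?_
      right_inv := ?_ }
  · obtain ⟨⟨⟨g, h⟩, x, y, z⟩, h1, h2, h3⟩ := q
    simp only [twist, cond_false, mul_inv_eq_iff_eq_mul] at h1 h2 h3
    obtain rfl := eq_mul_inv_of_mul_eq h1
    simp only [Commute, SemiconjBy]
    constructor
    · rw [mul_assoc, ← h2]; group
    · rw [mul_assoc, ← h3]; group
  · obtain ⟨x, ⟨h, u, v⟩, h1, h2⟩ := q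
    simp only [Commute, SemiconjBy] at h1 h2
    simp only [twist, cond_false, mul_inv_eq_iff_eq_mul]
    refine ⟨by group, ?_, ?_⟩
    · rw [mul_assoc x u h, ← h1]; group
    · rw [mul_assoc x v h, ← h2]; group
  · rintro ⟨⟨⟨g, h⟩, x, y, z⟩, h1, h2, h3⟩
    simp only [twist, cond_false, mul_inv_eq_iff_eq_mul] at h1
    simp [← h1]
  · rintro ⟨x, ⟨h, u, v⟩, h1, h2⟩
    simp

theorem sum_twist_false_card_fixed_swap :
    ∑ c : G × G, Nat.card {p : G × G // twist (false, c) (twist (false, c) p.1) = p.1 ∧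
        twist (false, c) p.2 = p.2}
      = Nat.card G * relCount 1 (fun x y : G => Commute (x ^ 2) y) := by
  rw [← card_subtype_prod_eq_sum fun (c : G × G) (p : G × G) =>
      twist (false, c) (twist (false, c) p.1) = p.1 ∧ twist (false, c) p.2 = p.2,
    ← card_related_pairs, ← Nat.card_prod]
  refine Nat.card_congr
    { toFun := fun q => (q.1.2.2, ⟨(q.1.1.2, q.1.2.2⁻¹ * q.1.2.1), ?_⟩)
      invFun := fun q => ⟨((q.1 * q.2.1.1 * q.1⁻¹, q.2.1.1), (q.1 * q.2.1.2, q.1)), ?_⟩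
      left_inv := ?_
      right_inv := ?_ }
  · obtain ⟨⟨⟨g, h⟩, x, z⟩, h1, h2⟩ := q
    simp only [twist, cond_false, mul_inv_eq_iff_eq_mul] at h1 h2
    obtain rfl := eq_mul_inv_of_mul_eq h2
    simp only [Commute, SemiconjBy]
    rw [← mul_assoc, mul_inv_eq_iff_eq_mul] at h1
    rw [pow_two, mul_assoc z⁻¹ x, ← mul_assoc x, ← h1]; group
  · obtain ⟨z, ⟨h, u⟩, h1⟩ := q
    simp only [Commute, SemiconjBy] at h1
    simp only [twist, cond_false, mul_inv_eq_iff_eq_mul]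
    refine ⟨?_, by group⟩
    rw [← mul_assoc, mul_inv_eq_iff_eq_mul,
      show z * u * h * h = z * (u * h ^ 2) by rw [pow_two]; simp only [mul_assoc], ← h1]
    simp [pow_two, mul_assoc]
  · rintro ⟨⟨⟨g, h⟩, x, z⟩, h1, h2⟩
    simp only [twist, cond_false, mul_inv_eq_iff_eq_mul] at h2
    simp [← h2]
  · rintro ⟨z, ⟨h, u⟩, h1⟩
    simp

/-- Triples `(x, p, h)` correspond to triples `(g, h, x)` with `g = x * p * x⁻¹`. -/
def conjEquiv : G × G × G ≃ (G × G) × G where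
  toFun q := ((q.1 * q.2.1 * q.1⁻¹, q.2.2), q.1)
  invFun q := (q.2, q.2⁻¹ * q.1.1 * q.2, q.1.2)
  left_inv q := by ext <;> simp [mul_assoc]
  right_inv q := by ext <;> simp [mul_assoc]

theorem sum_twist_false_card_fixed_cycle :
    ∑ c : G × G, Nat.card {x : G //
        twist (false, c) (twist (false, c) (twist (false, c) x)) = x}
      = Nat.card G * relCount 1 (fun x y : G => x ^ 3 = y ^ 3) := by
  rw [← card_subtype_prod_eq_sum fun (c : G × G) (x : G) =>
      twist (false, c) (twist (false, c) (twist (false, c) x)) = x,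
    ← card_related_pairs]
  refine card_subtype_eq_card_mul_of_equiv (conjEquiv G) _ _ ?_
  rintro x ⟨p, q⟩
  have : twist (false, x * p * x⁻¹, q) (twist (false, x * p * x⁻¹, q)
      (twist (false, x * p * x⁻¹, q) x)) = x * (p ^ 3 * (q ^ 3)⁻¹) := by
    simp [twist, pow_succ, mul_assoc]
  simp [conjEquiv, this, mul_inv_eq_one]

theorem sum_twist_false_card_fixed_pair :
    ∑ c : G × G, Nat.card {p : G × G // twist (false, c) p.1 = p.1 ∧ twist (false, c) p.2 = p.2}
      = Nat.card G * relCount 1 (Commute : G → G → Prop) := by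
  rw [← card_subtype_prod_eq_sum fun (c : G × G) (p : G × G) =>
      twist (false, c) p.1 = p.1 ∧ twist (false, c) p.2 = p.2,
    ← card_related_pairs, ← Nat.card_prod]
  refine Nat.card_congr
    { toFun := fun q => (q.1.2.1, ⟨(q.1.1.2, q.1.2.1⁻¹ * q.1.2.2), ?_⟩)
      invFun := fun q => ⟨((q.1 * q.2.1.1 * q.1⁻¹, q.2.1.1), (q.1, q.1 * q.2.1.2)), ?_⟩
      left_inv := ?_
      right_inv := ?_ }
  · obtain ⟨⟨⟨g, h⟩, x, y⟩, h1, h2⟩ := q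
    simp only [twist, cond_false, mul_inv_eq_iff_eq_mul] at h1 h2
    obtain rfl := eq_mul_inv_of_mul_eq h1
    simp only [Commute, SemiconjBy]
    rw [mul_assoc, ← h2]; group
  · obtain ⟨x, ⟨h, u⟩, h1⟩ := q
    simp only [Commute, SemiconjBy] at h1
    simp only [twist, cond_false, mul_inv_eq_iff_eq_mul]
    refine ⟨by group, ?_⟩
    rw [mul_assoc x u h, ← h1]; group
  · rintro ⟨⟨⟨g, h⟩, x, y⟩, h1, h2⟩
    simp only [twist, cond_false, mul_inv_eq_iff_eq_mul] at h1
    simp [← h1]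
  · rintro ⟨x, ⟨h, u⟩, h1⟩
    simp

theorem sum_twist_false_card_fixed_pair_swap :
    ∑ c : G × G, Nat.card {x : G // twist (false, c) (twist (false, c) x) = x}
      = Nat.card G * relCount 1 (fun x y : G => x ^ 2 = y ^ 2) := by
  rw [← card_subtype_prod_eq_sum fun (c : G × G) (x : G) =>
      twist (false, c) (twist (false, c) x) = x,
    ← card_related_pairs]
  refine card_subtype_eq_card_mul_of_equiv (conjEquiv G) _ _ ?_
  rintro x ⟨p, q⟩
  have : twist (false, x * p * x⁻¹, q) (twist (false, x * p * x⁻¹, q) x)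
      = x * (p ^ 2 * (q ^ 2)⁻¹) := by
    simp [twist, pow_succ, mul_assoc]
  simp [conjEquiv, this, mul_inv_eq_one]

omit [Fintype G] in
variable {G} in
theorem twist_true_eq_self_iff (c : G × G) (x : G) :
    twist (true, c) x = x ↔ c.1 = (x * c.2) ^ 2 * c.2⁻¹ := by
  have : (x * c.2) ^ 2 * c.2⁻¹ = x * c.2 * x := by simp [pow_two, mul_assoc]
  rw [this, twist, cond_true, mul_inv_eq_iff_eq_mul, mul_inv_eq_iff_eq_mul]

theorem sum_twist_true_card_fixed_triple :
    ∑ c : G × G, Nat.card {p : G × G × G // twist (true, c) p.1 = p.1 ∧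
        twist (true, c) p.2.1 = p.2.1 ∧ twist (true, c) p.2.2 = p.2.2}
      = Nat.card G * relCount 2 (fun x y : G => x ^ 2 = y ^ 2) := by
  rw [← card_subtype_prod_eq_sum fun (c : G × G) (p : G × G × G) => twist (true, c) p.1 = p.1 ∧
        twist (true, c) p.2.1 = p.2.1 ∧ twist (true, c) p.2.2 = p.2.2,
    ← card_related_triples, ← Nat.card_prod]
  simp only [twist_true_eq_self_iff]
  refine Nat.card_congr
    { toFun := fun q => (q.1.1.2,
        ⟨(q.1.2.1 * q.1.1.2, q.1.2.2.1 * q.1.1.2, q.1.2.2.2 * q.1.1.2), ?_⟩)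
      invFun := fun q => ⟨((q.2.1.1 ^ 2 * q.1⁻¹, q.1),
        (q.2.1.1 * q.1⁻¹, q.2.1.2.1 * q.1⁻¹, q.2.1.2.2 * q.1⁻¹)), ?_⟩
      left_inv := ?_
      right_inv := ?_ }
  · obtain ⟨⟨⟨g, h⟩, x, y, z⟩, h1, h2, h3⟩ := q
    exact ⟨mul_right_cancel (h1.symm.trans h2), mul_right_cancel (h1.symm.trans h3)⟩
  · obtain ⟨h, ⟨a, b, c⟩, h1, h2⟩ := q
    simpa using And.intro h1 h2
  · rintro ⟨⟨⟨g, h⟩, x, y, z⟩, h1, h2, h3⟩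
    simp [← h1]
  · rintro ⟨h, ⟨a, b, c⟩, h1, h2⟩
    simp

theorem sum_twist_true_card_fixed_pair :
    ∑ c : G × G, Nat.card {p : G × G // twist (true, c) p.1 = p.1 ∧ twist (true, c) p.2 = p.2}
      = Nat.card G * relCount 1 (fun x y : G => x ^ 2 = y ^ 2) := by
  rw [← card_subtype_prod_eq_sum fun (c : G × G) (p : G × G) => twist (true, c) p.1 = p.1 ∧
        twist (true, c) p.2 = p.2,
    ← card_related_pairs, ← Nat.card_prod]
  simp only [twist_true_eq_self_iff]
  refine Nat.card_congr
    { toFun := fun q => (q.1.1.2, ⟨(q.1.2.1 * q.1.1.2, q.1.2.2 * q.1.1.2), ?_⟩)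
      invFun := fun q => ⟨((q.2.1.1 ^ 2 * q.1⁻¹, q.1), (q.2.1.1 * q.1⁻¹, q.2.1.2 * q.1⁻¹)), ?_⟩
      left_inv := ?_
      right_inv := ?_ }
  · obtain ⟨⟨⟨g, h⟩, x, y⟩, h1, h2⟩ := q
    exact mul_right_cancel (h1.symm.trans h2)
  · obtain ⟨h, ⟨a, b⟩, h1⟩ := q
    simpa using h1
  · rintro ⟨⟨⟨g, h⟩, x, y⟩, h1, h2⟩
    simp [← h1]
  · rintro ⟨h, ⟨a, b⟩, h1⟩
    simp

omit [Fintype G] in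
variable {G} in
theorem twist_true_twist_true_mul_inv (k h a : G) :
    twist (true, k * h⁻¹, h) (twist (true, k * h⁻¹, h) (a * h⁻¹)) = k * a * k⁻¹ * h⁻¹ := by
  simp only [twist, cond_true]; group

theorem sum_twist_true_card_fixed_swap :
    ∑ c : G × G, Nat.card {p : G × G // twist (true, c) (twist (true, c) p.1) = p.1 ∧
        twist (true, c) p.2 = p.2}
      = Nat.card G * relCount 1 (fun x y : G => Commute (x ^ 2) y) := by
  rw [← card_subtype_prod_eq_sum fun (c : G × G) (p : G × G) =>
      twist (true, c) (twist (true, c) p.1) = p.1 ∧ twist (true, c) p.2 = p.2,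
    ← card_related_pairs, ← Nat.card_prod]
  simp only [twist_true_eq_self_iff]
  refine Nat.card_congr
    { toFun := fun q => (q.1.1.2, ⟨(q.1.2.2 * q.1.1.2, q.1.2.1 * q.1.1.2), ?_⟩)
      invFun := fun q => ⟨((q.2.1.1 ^ 2 * q.1⁻¹, q.1), (q.2.1.2 * q.1⁻¹, q.2.1.1 * q.1⁻¹)), ?_⟩
      left_inv := ?_
      right_inv := ?_ }
  · obtain ⟨⟨⟨g, h⟩, x, z⟩, h1, h2⟩ := q
    dsimp only at h1 h2 ⊢
    subst h2
    have := twist_true_twist_true_mul_inv ((z * h) ^ 2) h (x * h)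
    rw [mul_inv_cancel_right, h1, eq_mul_inv_iff_mul_eq, eq_mul_inv_iff_mul_eq] at this
    exact this.symm
  · obtain ⟨h, ⟨c, a⟩, h1⟩ := q
    refine ⟨?_, by simp⟩
    dsimp only
    rw [twist_true_twist_true_mul_inv, h1.eq, mul_inv_cancel_right]
  · rintro ⟨⟨⟨g, h⟩, x, z⟩, h1, h2⟩
    simp [← h2]
  · rintro ⟨h, ⟨c, a⟩, h1⟩
    simp

/-- Triples `(h, k, a)` correspond to triples `(g, h, x)` with `k = g * h` and `a = x * h`. -/
def mulEquiv : G × G × G ≃ (G × G) × G where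
  toFun q := ((q.2.1 * q.1⁻¹, q.1), q.2.2 * q.1⁻¹)
  invFun q := (q.1.2, q.1.1 * q.1.2, q.2 * q.1.2)
  left_inv q := by ext <;> simp
  right_inv q := by ext <;> simp

theorem sum_twist_true_card_fixed_pair_swap :
    ∑ c : G × G, Nat.card {x : G // twist (true, c) (twist (true, c) x) = x}
      = Nat.card G * relCount 1 (Commute : G → G → Prop) := by
  rw [← card_subtype_prod_eq_sum fun (c : G × G) (x : G) =>
      twist (true, c) (twist (true, c) x) = x,
    ← card_related_pairs]
  refine card_subtype_eq_card_mul_of_equiv (mulEquiv G) _ _ ?_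
  rintro h ⟨k, a⟩
  simp [mulEquiv, twist_true_twist_true_mul_inv, mul_inv_eq_iff_eq_mul, Commute, SemiconjBy]

theorem sum_twist_true_card_fixed_cycle :
    ∑ c : G × G, Nat.card {x : G //
        twist (true, c) (twist (true, c) (twist (true, c) x)) = x}
      = Nat.card G * relCount 1 (fun x y : G => x ^ 3 = y ^ 2) := by
  rw [← card_subtype_prod_eq_sum fun (c : G × G) (x : G) =>
      twist (true, c) (twist (true, c) (twist (true, c) x)) = x,
    ← card_related_pairs]
  refine card_subtype_eq_card_mul_of_equiv
    (((Equiv.refl G).prodCongr ((Equiv.refl G).prodShear fun k => Equiv.mulRight k⁻¹)).trans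
      (mulEquiv G)) _ _ ?_
  rintro h ⟨k, d⟩
  have : twist (true, k * h⁻¹, h) (twist (true, k * h⁻¹, h) (twist (true, k * h⁻¹, h)
      (d * k⁻¹ * h⁻¹))) = k ^ 3 * d⁻¹ * k⁻¹ * h⁻¹ := by
    rw [twist_true_twist_true_mul_inv]
    simp [twist, pow_succ, mul_assoc]
  simp [mulEquiv, Equiv.prodShear, this, mul_inv_eq_iff_eq_mul, pow_two]

end twistedAction

section invariants

variable (G : Type*) [Group G]

/-- The functions on `G × G × G` invariant under permutations of the coordinates, two-sided
translations and inversion. -/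
def invariantTriples : Submodule ℂ (G × G × G → ℂ) where
  carrier := { f : G × G × G → ℂ |
      (∀ x y z : G, f (y, x, z) = f (x, y, z)) ∧
      (∀ x y z : G, f (x, z, y) = f (x, y, z)) ∧
      (∀ g h x y z : G, f (g * x * h⁻¹, g * y * h⁻¹, g * z * h⁻¹) = f (x, y, z)) ∧
      (∀ x y z : G, f (x⁻¹, y⁻¹, z⁻¹) = f (x, y, z)) }
  zero_mem' := by simp
  add_mem' := by
    rintro f f' ⟨h1, h2, h3, h4⟩ ⟨h1', h2', h3', h4'⟩
    exact ⟨fun _ _ _ => congrArg₂ (· + ·) (h1 _ _ _) (h1' _ _ _),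
      fun _ _ _ => congrArg₂ (· + ·) (h2 _ _ _) (h2' _ _ _),
      fun _ _ _ _ _ => congrArg₂ (· + ·) (h3 _ _ _ _ _) (h3' _ _ _ _ _),
      fun _ _ _ => congrArg₂ (· + ·) (h4 _ _ _) (h4' _ _ _)⟩
  smul_mem' := by
    rintro c f ⟨h1, h2, h3, h4⟩
    exact ⟨fun _ _ _ => congrArg (c • ·) (h1 _ _ _), fun _ _ _ => congrArg (c • ·) (h2 _ _ _),
      fun _ _ _ _ _ => congrArg (c • ·) (h3 _ _ _ _ _),
      fun _ _ _ => congrArg (c • ·) (h4 _ _ _)⟩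

/-- The functions on `G × G` invariant under exchange of the coordinates, two-sided
translations and inversion. -/
def invariantPairs : Submodule ℂ (G × G → ℂ) where
  carrier := { f : G × G → ℂ |
      (∀ x y : G, f (y, x) = f (x, y)) ∧
      (∀ g h x y : G, f (g * x * h⁻¹, g * y * h⁻¹) = f (x, y)) ∧
      (∀ x y : G, f (x⁻¹, y⁻¹) = f (x, y)) }
  zero_mem' := by simp
  add_mem' := by
    rintro f f' ⟨h1, h2, h3⟩ ⟨h1', h2', h3'⟩
    exact ⟨fun _ _ => congrArg₂ (· + ·) (h1 _ _) (h1' _ _),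
      fun _ _ _ _ => congrArg₂ (· + ·) (h2 _ _ _ _) (h2' _ _ _ _),
      fun _ _ => congrArg₂ (· + ·) (h3 _ _) (h3' _ _)⟩
  smul_mem' := by
    rintro c f ⟨h1, h2, h3⟩
    exact ⟨fun _ _ => congrArg (c • ·) (h1 _ _), fun _ _ _ _ => congrArg (c • ·) (h2 _ _ _ _),
      fun _ _ => congrArg (c • ·) (h3 _ _)⟩

variable {G}

theorem invariantTriples_twist {f : G × G × G → ℂ} (hf : f ∈ invariantTriples G)
    (c : Bool × G × G) (x y z : G) : f (twist c x, twist c y, twist c z) = f (x, y, z) := by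
  obtain ⟨-, -, h3, h4⟩ := hf
  obtain ⟨_ | _, g, h⟩ := c
  · exact h3 g h x y z
  · exact (h3 g h _ _ _).trans (h4 x y z)

theorem invariantPairs_twist {f : G × G → ℂ} (hf : f ∈ invariantPairs G)
    (c : Bool × G × G) (x y : G) : f (twist c x, twist c y) = f (x, y) := by
  obtain ⟨-, h2, h3⟩ := hf
  obtain ⟨_ | _, g, h⟩ := c
  · exact h2 g h x y
  · exact (h2 g h _ _).trans (h3 x y)

/-- Precomposition of a twisted translation with inversion. -/
def twistInvEquiv : Bool × G × G ≃ Bool × G × G := Equiv.boolNot.prodCongr (Equiv.refl _)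

theorem twist_inv (c : Bool × G × G) (x : G) : twist c x⁻¹ = twist (twistInvEquiv c) x := by
  obtain ⟨_ | _, g, h⟩ := c <;> simp [twist, twistInvEquiv]

/-- Precomposition of a twisted translation with the two-sided translation by `(g, h)`. -/
def twistMulEquiv (g h : G) : Bool × G × G ≃ Bool × G × G :=
  (Equiv.refl Bool).prodShear fun b =>
    (Equiv.mulRight (bif b then h else g)).prodCongr (Equiv.mulRight (bif b then g else h))

theorem twist_mul (g h : G) (c : Bool × G × G) (x : G) :
    twist c (g * x * h⁻¹) = twist (twistMulEquiv g h c) x := by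
  obtain ⟨_ | _, g, h⟩ := c <;> simp [twist, twistMulEquiv, Equiv.prodShear, mul_assoc]

variable (G)

theorem card_mul_finrank_invariantTriples [Fintype G] :
    12 * Nat.card G * finrank ℂ (invariantTriples G)
      = relCount 2 (Commute : G → G → Prop)
        + 6 * relCount 1 (fun x y : G => Commute (x ^ 2) y)
        + 2 * relCount 1 (fun x y : G => x ^ 3 = y ^ 3)
        + relCount 2 (fun x y : G => x ^ 2 = y ^ 2)
        + 2 * relCount 1 (fun x y : G => x ^ 3 = y ^ 2) := by
  have key := card_mul_finrank_eq_card_fixed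
    (fun (e : (Bool × G × G) × Fin 6) (p : G × G × G) =>
      permTriple e.2 (twist e.1 p.1, twist e.1 p.2.1, twist e.1 p.2.2)) (invariantTriples G)
    (by
      rintro f hf ⟨c, i⟩ ⟨x, y, z⟩
      rw [← invariantTriples_twist hf c x y z]
      obtain ⟨h1, h2, -⟩ := hf
      have h3 (x y z) : f (z, y, x) = f (x, y, z) := by rw [h1, h2, h1]
      have h4 (x y z) : f (y, z, x) = f (x, y, z) := by rw [h2, h1]
      have h5 (x y z) : f (z, x, y) = f (x, y, z) := by rw [h1, h2]
      fin_cases i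
      · rfl
      · exact h1 _ _ _
      · exact h2 _ _ _
      · exact h3 _ _ _
      · exact h4 _ _ _
      · exact h5 _ _ _)
    (by
      intro f
      simp only [Fintype.sum_prod_type (α₁ := Bool × G × G) (α₂ := Fin 6)]
      refine ⟨?_, ?_, ?_, ?_⟩
      · intro x y z
        refine Finset.sum_congr rfl fun c _ => ?_
        simp only [Fin.sum_univ_six, permTriple, Matrix.cons_val]
        ring
      · intro x y z
        refine Finset.sum_congr rfl fun c _ => ?_
        simp only [Fin.sum_univ_six, permTriple, Matrix.cons_val]
        ring
      · intro g h x y z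
        refine Fintype.sum_equiv (twistMulEquiv g h) _ _ fun c => ?_
        simp only [twist_mul]
      · intro x y z
        refine Fintype.sum_equiv twistInvEquiv _ _ fun c => ?_
        simp only [twist_inv])
  rw [card_subtype_prod_eq_sum fun (e : (Bool × G × G) × Fin 6) (p : G × G × G) =>
    permTriple e.2 (twist e.1 p.1, twist e.1 p.2.1, twist e.1 p.2.2) = p] at key
  rw [Fintype.sum_prod_type] at key
  simp only [sum_card_fixed_permTriple, Finset.sum_add_distrib, ← Finset.mul_sum] at key
  simp only [Fintype.sum_prod_type (α₁ := Bool), Fintype.sum_bool,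
    sum_twist_false_card_fixed_triple, sum_twist_true_card_fixed_triple,
    sum_twist_false_card_fixed_swap, sum_twist_true_card_fixed_swap,
    sum_twist_false_card_fixed_cycle, sum_twist_true_card_fixed_cycle,
    Nat.card_prod, Nat.card_eq_fintype_card (α := Bool), Fintype.card_bool, Nat.card_fin] at key
  apply Nat.eq_of_mul_eq_mul_left (Nat.card_pos (α := G))
  linarith

theorem card_mul_finrank_invariantPairs [Fintype G] :
    2 * Nat.card G * finrank ℂ (invariantPairs G)
      = relCount 1 (Commute : G → G → Prop) + relCount 1 (fun x y : G => x ^ 2 = y ^ 2) := by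
  have key := card_mul_finrank_eq_card_fixed
    (fun (e : (Bool × G × G) × Fin 2) (p : G × G) =>
      permPair e.2 (twist e.1 p.1, twist e.1 p.2)) (invariantPairs G)
    (by
      rintro f hf ⟨c, i⟩ ⟨x, y⟩
      rw [← invariantPairs_twist hf c x y]
      fin_cases i
      · rfl
      · exact hf.1 _ _)
    (by
      intro f
      simp only [Fintype.sum_prod_type (α₁ := Bool × G × G) (α₂ := Fin 2)]
      refine ⟨?_, ?_, ?_⟩
      · intro x y
        refine Finset.sum_congr rfl fun c _ => ?_
        simp only [Fin.sum_univ_two, permPair, Matrix.cons_val]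
        ring
      · intro g h x y
        refine Fintype.sum_equiv (twistMulEquiv g h) _ _ fun c => ?_
        simp only [twist_mul]
      · intro x y
        refine Fintype.sum_equiv twistInvEquiv _ _ fun c => ?_
        simp only [twist_inv])
  rw [card_subtype_prod_eq_sum fun (e : (Bool × G × G) × Fin 2) (p : G × G) =>
    permPair e.2 (twist e.1 p.1, twist e.1 p.2) = p] at key
  rw [Fintype.sum_prod_type] at key
  simp only [sum_card_fixed_permPair, Finset.sum_add_distrib] at key
  simp only [Fintype.sum_prod_type (α₁ := Bool), Fintype.sum_bool,
    sum_twist_false_card_fixed_pair, sum_twist_true_card_fixed_pair,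
    sum_twist_false_card_fixed_pair_swap, sum_twist_true_card_fixed_pair_swap,
    Nat.card_prod, Nat.card_eq_fintype_card (α := Bool), Fintype.card_bool, Nat.card_fin] at key
  apply Nat.eq_of_mul_eq_mul_left (Nat.card_pos (α := G))
  linarith

theorem dimAThetaOddGroupAlgebra_eq :
    dimAThetaOddGroupAlgebra G = finrank ℂ (invariantTriples G) := by
  rw [← Submodule.span_eq (invariantTriples G)]; rfl

variable {G}

/-- Summation over the last coordinate. -/
def marginal [Fintype G] : invariantTriples G →ₗ[ℂ] invariantPairs G where
  toFun f := ⟨fun p => ∑ z, f.1 (p.1, p.2, z), by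
    obtain ⟨f, h1, h2, h3, h4⟩ := f
    refine ⟨fun x y => ?_, fun g h x y => ?_, fun x y => ?_⟩
    · exact Finset.sum_congr rfl fun z _ => h1 _ _ _
    · refine (Fintype.sum_equiv ((Equiv.mulLeft g).trans (Equiv.mulRight h⁻¹)) _ _ fun z => ?_).symm
      exact (h3 g h x y z).symm
    · exact (Fintype.sum_equiv (Equiv.inv G) _ _ fun z => (h4 x y z).symm).symm⟩
  map_add' f g := by ext p; simp [Finset.sum_add_distrib]
  map_smul' c f := by ext p; simp [Finset.mul_sum]

theorem marginal_surjective [Fintype G] : Function.Surjective (marginal (G := G)) := by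
  rintro ⟨h, h1, h2, h3⟩
  set n : ℂ := (Fintype.card G : ℂ) with hn
  have hn0 : n ≠ 0 := Nat.cast_ne_zero.2 Fintype.card_ne_zero
  set r : ℂ := ∑ z, h (1, z) with hr
  have hrow (x : G) : ∑ z, h (x, z) = r :=
    Fintype.sum_equiv (Equiv.mulLeft x⁻¹) _ _ fun z => by
      simpa using (h2 x⁻¹ 1 x z).symm
  refine ⟨⟨fun p => n⁻¹ * (h (p.1, p.2.1) + h (p.1, p.2.2) + h (p.2.1, p.2.2))
    - 2 * n⁻¹ ^ 2 * r, ?_, ?_, ?_, ?_⟩, ?_⟩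
  · intro x y z
    simp only [h1 x y]
    ring
  · intro x y z
    simp only [h1 y z]
    ring
  · intro g k x y z
    simp only [h2]
  · intro x y z
    simp only [h3]
  · ext ⟨x, y⟩
    simp only [marginal, LinearMap.coe_mk, AddHom.coe_mk, Finset.sum_sub_distrib,
      ← Finset.mul_sum, Finset.sum_add_distrib, hrow, Finset.sum_const, Finset.card_univ,
      nsmul_eq_mul, ← hn]
    field_simp
    ring

theorem dimAThetaOddKerAug_eq [Fintype G] :
    dimAThetaOddKerAug G = finrank ℂ (LinearMap.ker (marginal (G := G))) := by
  have hset : ((LinearMap.ker (marginal (G := G))).map (invariantTriples G).subtype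
        : Set (G × G × G → ℂ)) = { f : G × G × G → ℂ |
      (∀ x y z : G, f (y, x, z) = f (x, y, z)) ∧
      (∀ x y z : G, f (x, z, y) = f (x, y, z)) ∧
      (∀ g h x y z : G, f (g * x * h⁻¹, g * y * h⁻¹, g * z * h⁻¹) = f (x, y, z)) ∧
      (∀ x y z : G, f (x⁻¹, y⁻¹, z⁻¹) = f (x, y, z)) ∧
      (∀ y z : G, ∑ᶠ x : G, f (x, y, z) = 0) ∧
      (∀ x z : G, ∑ᶠ y : G, f (x, y, z) = 0) ∧
      (∀ x y : G, ∑ᶠ z : G, f (x, y, z) = 0) } := by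
    ext f
    simp only [Submodule.map_coe, Set.mem_image, finsum_eq_sum_of_fintype, Set.mem_ofPred_eq,
      SetLike.mem_coe, LinearMap.mem_ker]
    constructor
    · rintro ⟨⟨f, h1, h2, h3, h4⟩, hf, rfl⟩
      have h (x y : G) : ∑ z, f (x, y, z) = 0 := congrFun (congrArg Subtype.val hf) (x, y)
      refine ⟨h1, h2, h3, h4, fun y z => ?_, fun x z => ?_, h⟩
      · rw [← h y z]
        exact Finset.sum_congr rfl fun x _ => (h1 y x z).trans (h2 _ _ _)
      · rw [← h x z]
        exact Finset.sum_congr rfl fun y _ => h2 _ _ _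
    · rintro ⟨h1, h2, h3, h4, -, -, h⟩
      exact ⟨⟨f, h1, h2, h3, h4⟩, Subtype.ext (funext fun p => h p.1 p.2), rfl⟩
  rw [dimAThetaOddKerAug, ← hset, Submodule.span_eq]
  exact (Submodule.equivMapOfInjective _ (Submodule.subtype_injective _) _).finrank_eq.symm

theorem dimAThetaOddKerAug_add [Fintype G] :
    dimAThetaOddKerAug G + finrank ℂ (invariantPairs G) = dimAThetaOddGroupAlgebra G := by
  rw [dimAThetaOddKerAug_eq, dimAThetaOddGroupAlgebra_eq,
    ← LinearMap.finrank_range_add_finrank_ker (marginal (G := G)),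
    LinearMap.range_eq_top.2 marginal_surjective, finrank_top, add_comm]

end invariants

namespace BinaryOctahedral

/-- Codes for the elements: `(j, k)` stands for the `k`-th element of the `j`-th left coset of
the cyclic subgroup generated by `b`. -/
abbrev Code : Type := Fin 6 × Fin 8

/-- Left multiplication by `a` on codes. -/
def mulA (p : Code) : Code :=
  (![1, 2, 0, 4, 5, 3] p.1, p.2 + ![0, 1, 3, 7, 0, 5] p.1)

/-- Left multiplication by `b` on codes. -/
def mulB (p : Code) : Code :=
  (![0, 2, 3, 4, 1, 5] p.1, p.2 + ![1, 0, 0, 0, 4, 7] p.1)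

/-- `mulA` as a permutation. -/
def permA : Equiv.Perm Code where
  toFun := mulA
  invFun := mulA^[5]
  left_inv := by decide +kernel
  right_inv := by decide +kernel

/-- `mulB` as a permutation. -/
def permB : Equiv.Perm Code where
  toFun := mulB
  invFun := mulB^[7]
  left_inv := by decide +kernel
  right_inv := by decide +kernel

/-- Representatives of the left cosets of the subgroup generated by `b`. -/
def cosetRep {M : Type*} [Monoid M] (a b : M) : Fin 6 → M :=
  ![1, a, b * a, b * (b * a), b * (b * (b * a)), a * (b * (b * (b * a)))]

/-- The element of `M` with a given code. -/
def word {M : Type*} [Monoid M] (a b : M) (p : Code) : M :=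
  cosetRep a b p.1 * b ^ (p.2 : ℕ)

theorem map_word {M N : Type*} [Monoid M] [Monoid N] (f : M →* N) (a b : M) (p : Code) :
    f (word a b p) = word (f a) (f b) p := by
  obtain ⟨j, k⟩ := p
  fin_cases j <;> simp [word, cosetRep]

/-- The product of two codes. -/
def mulCode (p q : Code) : Code :=
  let r := mulB^[(p.2 : ℕ)] q
  ![r, mulA r, mulB (mulA r), mulB (mulB (mulA r)), mulB (mulB (mulB (mulA r))),
    mulA (mulB (mulB (mulB (mulA r))))] p.1

theorem word_perm_apply (p q : Code) : word permA permB p q = mulCode p q := by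
  have h (k : ℕ) : (permB ^ k) q = mulB^[k] q := by
    rw [← Equiv.Perm.iterate_eq_pow]; rfl
  obtain ⟨j, k⟩ := p
  fin_cases j <;> simp [word, cosetRep, mulCode, h] <;> rfl

section relations

variable {G : Type*} [Group G] {a b : G}

theorem b_mul_a (h₁ : (a * b) ^ 2 = a ^ 3) : b * a = a * a * b⁻¹ := by
  rw [eq_mul_inv_iff_mul_eq]
  apply mul_left_cancel (a := a)
  simpa [pow_succ, mul_assoc] using h₁

theorem a_mul_b_mul_a (h₁ : (a * b) ^ 2 = a ^ 3) (h₂ : a ^ 3 = b ^ 4) :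
    a * b * a = b ^ 3 := by
  have : a * b * a * b = b ^ 3 * b := by
    rw [← pow_succ, ← h₂, ← h₁, pow_two, mul_assoc, mul_assoc]
  exact mul_right_cancel this

theorem b_pow_four_mul_a (h₂ : a ^ 3 = b ^ 4) : b ^ 4 * a = a * b ^ 4 := by
  rw [← h₂, ← pow_succ, ← pow_succ']

theorem a_mul_b_sq_mul_a (h₁ : (a * b) ^ 2 = a ^ 3) (h₂ : a ^ 3 = b ^ 4) :
    a * b ^ 2 * a = b ^ 3 * a * b⁻¹ := by
  have h3 := a_mul_b_mul_a h₁ h₂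
  have h4 := b_mul_a h₁
  calc a * b ^ 2 * a = a * b * (b * a) := by simp only [pow_two, mul_assoc]
    _ = (a * b * a) * a * b⁻¹ := by rw [h4]; group
    _ = _ := by rw [h3]

theorem b_mul_a_mul_b_cube_mul_a (h₁ : (a * b) ^ 2 = a ^ 3) (h₂ : a ^ 3 = b ^ 4) :
    b * (a * b ^ 3 * a) = a * b ^ 3 * a * b⁻¹ := by
  calc b * (a * b ^ 3 * a) = (b * a) * b ^ 3 * a := by group
    _ = a * (a * b ^ 2 * a) := by rw [b_mul_a h₁]; group
    _ = _ := by rw [a_mul_b_sq_mul_a h₁ h₂]; group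

theorem b_pow_eight (h₁ : (a * b) ^ 2 = a ^ 3) (h₂ : a ^ 3 = b ^ 4) : b ^ 8 = 1 := by
  set c := a * b ^ 3 * a with hc
  have h : b * c * b = c := by
    rw [hc, b_mul_a_mul_b_cube_mul_a h₁ h₂, inv_mul_cancel_right]
  have h4 : b ^ 4 * c * b ^ 4 = c := by
    calc b ^ 4 * c * b ^ 4 = b * (b * (b * (b * c * b) * b) * b) * b := by
          simp only [pow_succ, pow_zero, one_mul, mul_assoc]
      _ = c := by simp only [h]
  have hz := b_pow_four_mul_a h₂
  have hcomm : b ^ 4 * c = c * b ^ 4 := by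
    have hA : Commute (b ^ 4) a := hz
    have hB : Commute (b ^ 4) (b ^ 3) := (Commute.refl b).pow_pow 4 3
    exact ((hA.mul_right hB).mul_right hA).eq
  rw [hcomm, mul_assoc, ← pow_add] at h4
  simpa using h4

theorem pow_val_add (hb : b ^ 8 = 1) (k l : Fin 8) :
    b ^ ((k + l : Fin 8) : ℕ) = b ^ (l : ℕ) * b ^ (k : ℕ) := by
  rw [Fin.val_add, ← pow_add, add_comm (k : ℕ)]
  exact (pow_eq_pow_mod _ hb).symm

theorem word_mulA (h₁ : (a * b) ^ 2 = a ^ 3) (h₂ : a ^ 3 = b ^ 4) (p : Code) :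
    word a b (mulA p) = a * word a b p := by
  have hb := b_pow_eight h₁ h₂
  have h7 : b ^ 7 = b⁻¹ := by rw [eq_inv_iff_mul_eq_one, ← pow_succ, hb]
  have hj : ∀ j : Fin 6, cosetRep a b (![1, 2, 0, 4, 5, 3] j) *
      b ^ ((![0, 1, 3, 7, 0, 5] j : Fin 8) : ℕ) = a * cosetRep a b j := by
    have e1 : b * a * b = a * a := by rw [b_mul_a h₁]; group
    have e2 := a_mul_b_mul_a h₁ h₂
    have e3 := a_mul_b_sq_mul_a h₁ h₂
    have e5 : b * (b * a) * b ^ 5 = a * (a * (b * (b * (b * a)))) := by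
      have e6 : b * a ^ 3 = a ^ 3 * b := by rw [h₂, ← pow_succ, ← pow_succ']
      calc b * (b * a) * b ^ 5 = b * (b * a * b ^ 4) * b := by
            simp only [pow_succ, pow_zero, one_mul, mul_assoc]
        _ = b * ((b * a ^ 3) * (a * b)) := by
            rw [← h₂]; simp only [pow_succ, pow_zero, one_mul, mul_assoc]
        _ = b * (a ^ 3 * (b * a * b)) := by rw [e6]; simp only [mul_assoc]
        _ = b * a * a ^ 3 * a := by
            rw [e1]; simp only [pow_succ, pow_zero, one_mul, mul_assoc]
        _ = (b * a * b) * b ^ 3 * a := by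
            rw [h₂]; simp only [pow_succ, pow_zero, one_mul, mul_assoc]
        _ = _ := by rw [e1]; simp only [pow_succ, pow_zero, one_mul, mul_assoc]
    intro j
    fin_cases j
    · simp [cosetRep]
    · simpa [cosetRep] using e1
    · simpa [cosetRep, mul_assoc] using e2.symm
    · simpa [cosetRep, h7, mul_assoc, pow_succ] using e3.symm
    · simp [cosetRep]
    · simpa [cosetRep] using e5
  rw [word, word, ← mul_assoc, ← hj, mul_assoc, mulA, pow_val_add hb]

theorem word_mulB (h₁ : (a * b) ^ 2 = a ^ 3) (h₂ : a ^ 3 = b ^ 4) (p : Code) :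
    word a b (mulB p) = b * word a b p := by
  have hb := b_pow_eight h₁ h₂
  have h7 : b ^ 7 = b⁻¹ := by rw [eq_inv_iff_mul_eq_one, ← pow_succ, hb]
  have hj : ∀ j : Fin 6, cosetRep a b (![0, 2, 3, 4, 1, 5] j) *
      b ^ ((![1, 0, 0, 0, 4, 7] j : Fin 8) : ℕ) = b * cosetRep a b j := by
    have e4 := b_pow_four_mul_a h₂
    have e5 := b_mul_a_mul_b_cube_mul_a h₁ h₂
    intro j
    fin_cases j
    · simp [cosetRep]
    · simp [cosetRep]
    · simp [cosetRep]
    · simp [cosetRep]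
    · simpa [cosetRep, mul_assoc, pow_succ] using e4.symm
    · simpa [cosetRep, h7, mul_assoc, pow_succ] using e5.symm
  rw [word, word, ← mul_assoc, ← hj, mul_assoc, mulB, pow_val_add hb]

end relations

/-- The generator `a`. -/
def genA : binaryOctahedralGroup := PresentedGroup.of 0

/-- The generator `b`. -/
def genB : binaryOctahedralGroup := PresentedGroup.of 1

theorem genA_mul_genB_sq : (genA * genB) ^ 2 = genA ^ 3 := by
  rw [← mul_inv_eq_one]
  exact PresentedGroup.one_of_mem (Or.inl rfl)

theorem genA_cube : genA ^ 3 = genB ^ 4 := by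
  rw [← mul_inv_eq_one]
  exact PresentedGroup.one_of_mem (Or.inr rfl)

/-- The permutation representation on codes. -/
def perm : binaryOctahedralGroup →* Equiv.Perm Code :=
  PresentedGroup.toGroup (f := ![permA, permB]) (by
    rintro r (rfl | rfl)
    · simp only [map_mul, map_pow, map_inv, FreeGroup.lift_apply_of, Matrix.cons_val_zero,
        Matrix.cons_val_one, mul_inv_eq_one]
      ext1 p
      revert p
      decide +kernel
    · simp only [map_mul, map_pow, map_inv, FreeGroup.lift_apply_of, Matrix.cons_val_zero,
        Matrix.cons_val_one, mul_inv_eq_one]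
      ext1 p
      revert p
      decide +kernel)

theorem perm_genA : perm genA = permA := PresentedGroup.toGroup.of _

theorem perm_genB : perm genB = permB := PresentedGroup.toGroup.of _

theorem perm_word (p q : Code) : perm (word genA genB p) q = mulCode p q := by
  rw [map_word, perm_genA, perm_genB, word_perm_apply]

theorem word_perm (g : binaryOctahedralGroup) :
    ∀ p, word genA genB (perm g p) = g * word genA genB p := by
  have hA (p) : word genA genB (permA p) = genA * word genA genB p :=
    word_mulA genA_mul_genB_sq genA_cube p
  have hB (p) : word genA genB (permB p) = genB * word genA genB p :=
    word_mulB genA_mul_genB_sq genA_cube p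
  have hof : ∀ i p, word genA genB (perm (PresentedGroup.of i) p)
      = PresentedGroup.of i * word genA genB p := by
    intro i p
    fin_cases i
    · exact (congrArg (fun σ : Equiv.Perm Code => word genA genB (σ p)) perm_genA).trans (hA p)
    · exact (congrArg (fun σ : Equiv.Perm Code => word genA genB (σ p)) perm_genB).trans (hB p)
  have hg : g ∈ Subgroup.closure
      (Set.range (PresentedGroup.of : Fin 2 → binaryOctahedralGroup)) := by
    rw [PresentedGroup.closure_range_of]; trivial
  induction hg using Subgroup.closure_induction with
  | mem x hx => obtain ⟨i, rfl⟩ := hx; exact hof i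
  | one => simp
  | mul x y _ _ hx hy => intro p; rw [map_mul, Equiv.Perm.mul_apply, hx, hy, mul_assoc]
  | inv x _ hx =>
    intro p
    rw [eq_inv_mul_iff_mul_eq, ← hx, ← Equiv.Perm.mul_apply, ← map_mul]
    simp

/-- The coding of the elements of the binary octahedral group. -/
def codeEquiv : Code ≃ binaryOctahedralGroup where
  toFun := word genA genB
  invFun g := perm g (0, 0)
  left_inv p := by
    change perm (word genA genB p) (0, 0) = p
    rw [perm_word]
    revert p
    decide +kernel
  right_inv g := (word_perm g (0, 0)).trans (by simp [word, cosetRep])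

theorem codeEquiv_mulCode (p q : Code) :
    codeEquiv (mulCode p q) = codeEquiv p * codeEquiv q := by
  rw [← perm_word]
  exact word_perm _ _

/-- The squares of the codes. -/
def sqCode (p : Code) : Code :=
  ((![![(0, 0), (0, 2), (0, 4), (0, 6), (0, 0), (0, 2), (0, 4), (0, 6)],
    ![(2, 1), (0, 4), (4, 1), (5, 3), (2, 1), (0, 4), (4, 1), (5, 3)],
    ![(0, 4), (1, 4), (5, 1), (3, 0), (0, 4), (1, 4), (5, 1), (3, 0)],
    ![(2, 3), (5, 7), (4, 7), (0, 4), (2, 3), (5, 7), (4, 7), (0, 4)],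
    ![(5, 5), (1, 2), (0, 4), (3, 2), (5, 5), (1, 2), (0, 4), (3, 2)],
    ![(0, 4), (0, 4), (0, 4), (0, 4), (0, 4), (0, 4), (0, 4), (0, 4)]] :
    Fin 6 → Fin 8 → Code) p.1 p.2)

/-- The cubes of the codes. -/
def cubeCode (p : Code) : Code :=
  ((![![(0, 0), (0, 3), (0, 6), (0, 1), (0, 4), (0, 7), (0, 2), (0, 5)],
    ![(0, 4), (1, 5), (0, 0), (3, 5), (0, 0), (1, 1), (0, 4), (3, 1)],
    ![(2, 4), (0, 0), (4, 4), (0, 0), (2, 0), (0, 4), (4, 0), (0, 4)],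
    ![(0, 0), (1, 7), (0, 0), (3, 7), (0, 4), (1, 3), (0, 4), (3, 3)],
    ![(2, 6), (0, 0), (4, 6), (0, 4), (2, 2), (0, 4), (4, 2), (0, 0)],
    ![(5, 4), (5, 5), (5, 6), (5, 7), (5, 0), (5, 1), (5, 2), (5, 3)]] :
    Fin 6 → Fin 8 → Code) p.1 p.2)

theorem mulCode_self : ∀ p, mulCode p p = sqCode p := by decide +kernel

theorem mulCode_sqCode : ∀ p, mulCode p (sqCode p) = cubeCode p := by decide +kernel

theorem codeEquiv_sqCode (p : Code) : codeEquiv (sqCode p) = codeEquiv p ^ 2 := by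
  simp only [← mulCode_self, codeEquiv_mulCode, pow_two]

theorem codeEquiv_cubeCode (p : Code) : codeEquiv (cubeCode p) = codeEquiv p ^ 3 := by
  simp only [← mulCode_sqCode, ← pow_succ', codeEquiv_mulCode, codeEquiv_sqCode]

/-- The binary octahedral group is finite. -/
instance : Fintype binaryOctahedralGroup := Fintype.ofEquiv Code codeEquiv

theorem card_binaryOctahedralGroup : Nat.card binaryOctahedralGroup = 48 := by
  rw [← Nat.card_congr codeEquiv]
  simp

theorem relCount_eq_sum_codes (k : ℕ) (R : binaryOctahedralGroup → binaryOctahedralGroup → Prop)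
    (R' : Code → Code → Prop) [∀ p q, Decidable (R' p q)]
    (h : ∀ p q, R' p q ↔ R (codeEquiv p) (codeEquiv q)) :
    relCount k R = ∑ p, Fintype.card {q // R' p q} ^ k := by
  rw [← relCount_congr k codeEquiv R' R h]
  simp only [relCount, Nat.card_eq_fintype_card]

theorem commute_codeEquiv_iff (p q : Code) :
    mulCode p q = mulCode q p ↔ Commute (codeEquiv p) (codeEquiv q) := by
  rw [← codeEquiv.injective.eq_iff, codeEquiv_mulCode, codeEquiv_mulCode, commute_iff_eq]

theorem relCount_one_commute :
    relCount 1 (Commute : binaryOctahedralGroup → binaryOctahedralGroup → Prop) = 48 * 8 := by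
  rw [relCount_eq_sum_codes 1 _ _ commute_codeEquiv_iff]
  decide +kernel

theorem relCount_two_commute :
    relCount 2 (Commute : binaryOctahedralGroup → binaryOctahedralGroup → Prop) = 48 * 136 := by
  rw [relCount_eq_sum_codes 2 _ _ commute_codeEquiv_iff]
  decide +kernel

theorem relCount_sq_commute :
    relCount 1 (fun x y : binaryOctahedralGroup => Commute (x ^ 2) y) = 48 * 24 := by
  rw [relCount_eq_sum_codes 1 _ (fun p q => mulCode (sqCode p) q = mulCode q (sqCode p))
    fun p q => by rw [commute_codeEquiv_iff, codeEquiv_sqCode]]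
  decide +kernel

theorem relCount_one_sq_eq_sq :
    relCount 1 (fun x y : binaryOctahedralGroup => x ^ 2 = y ^ 2) = 48 * 8 := by
  rw [relCount_eq_sum_codes 1 _ (fun p q => sqCode p = sqCode q)
    fun p q => by rw [← codeEquiv_sqCode, ← codeEquiv_sqCode, codeEquiv.injective.eq_iff]]
  decide +kernel

theorem relCount_two_sq_eq_sq :
    relCount 2 (fun x y : binaryOctahedralGroup => x ^ 2 = y ^ 2) = 48 * 124 := by
  rw [relCount_eq_sum_codes 2 _ (fun p q => sqCode p = sqCode q)
    fun p q => by rw [← codeEquiv_sqCode, ← codeEquiv_sqCode, codeEquiv.injective.eq_iff]]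
  decide +kernel

theorem relCount_cube_eq_cube :
    relCount 1 (fun x y : binaryOctahedralGroup => x ^ 3 = y ^ 3) = 48 * 4 := by
  rw [relCount_eq_sum_codes 1 _ (fun p q => cubeCode p = cubeCode q)
    fun p q => by rw [← codeEquiv_cubeCode, ← codeEquiv_cubeCode, codeEquiv.injective.eq_iff]]
  decide +kernel

theorem relCount_cube_eq_sq :
    relCount 1 (fun x y : binaryOctahedralGroup => x ^ 3 = y ^ 2) = 48 * 4 := by
  rw [relCount_eq_sum_codes 1 _ (fun p q => cubeCode p = sqCode q)
    fun p q => by rw [← codeEquiv_cubeCode, ← codeEquiv_sqCode, codeEquiv.injective.eq_iff]]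
  decide +kernel

end BinaryOctahedral

section product

open BinaryOctahedral

variable (A : Type*) [CommGroup A] [Fintype A]

theorem dimAThetaOddGroupAlgebra_prod_binaryOctahedralGroup (h : (Nat.card A).Coprime 6) :
    3 * dimAThetaOddGroupAlgebra (A × binaryOctahedralGroup)
      = 34 * Nat.card A ^ 2 + 36 * Nat.card A + 35 := by
  have h2 : (Nat.card A).Coprime 2 := h.coprime_dvd_right (by norm_num)
  have h3 : (Nat.card A).Coprime 3 := h.coprime_dvd_right (by norm_num)
  have key := card_mul_finrank_invariantTriples (A × binaryOctahedralGroup)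
  rw [relCount_prod 2 Commute Commute Commute fun _ _ => Prod.commute_iff,
    relCount_prod 1 _ (fun x y => Commute (x ^ 2) y) (fun x y => Commute (x ^ 2) y)
      fun _ _ => Prod.commute_iff,
    relCount_prod 1 _ (fun x y => x ^ 3 = y ^ 3) (fun x y => x ^ 3 = y ^ 3)
      fun _ _ => Prod.ext_iff,
    relCount_prod 2 _ (fun x y => x ^ 2 = y ^ 2) (fun x y => x ^ 2 = y ^ 2)
      fun _ _ => Prod.ext_iff,
    relCount_prod 1 _ (fun x y => x ^ 3 = y ^ 2) (fun x y => x ^ 3 = y ^ 2)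
      fun _ _ => Prod.ext_iff,
    relCount_two_commute, relCount_sq_commute, relCount_cube_eq_cube, relCount_two_sq_eq_sq,
    relCount_cube_eq_sq, relCount_commute_of_comm, relCount_sq_commute_of_comm,
    relCount_pow_eq_pow_of_coprime _ _ _ h3, relCount_pow_eq_pow_of_coprime _ _ _ h2,
    relCount_pow_eq_pow_of_coprime _ _ _ h2, Nat.card_prod, card_binaryOctahedralGroup,
    ← dimAThetaOddGroupAlgebra_eq] at key
  apply Nat.eq_of_mul_eq_mul_left (Nat.card_pos (α := A))
  linarith

theorem finrank_invariantPairs_prod_binaryOctahedralGroup (h : (Nat.card A).Coprime 6) :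
    finrank ℂ (invariantPairs (A × binaryOctahedralGroup)) = 4 * Nat.card A + 4 := by
  have h2 : (Nat.card A).Coprime 2 := h.coprime_dvd_right (by norm_num)
  have key := card_mul_finrank_invariantPairs (A × binaryOctahedralGroup)
  rw [relCount_prod 1 Commute Commute Commute fun _ _ => Prod.commute_iff,
    relCount_prod 1 _ (fun x y => x ^ 2 = y ^ 2) (fun x y => x ^ 2 = y ^ 2)
      fun _ _ => Prod.ext_iff,
    relCount_one_commute, relCount_one_sq_eq_sq, relCount_commute_of_comm,
    relCount_pow_eq_pow_of_coprime _ _ _ h2, Nat.card_prod, card_binaryOctahedralGroup] at key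
  apply Nat.eq_of_mul_eq_mul_left (Nat.card_pos (α := A))
  linarith

theorem dimAThetaOddGroupAlgebra_binaryOctahedralGroup :
    dimAThetaOddGroupAlgebra binaryOctahedralGroup = 35 := by
  have key := card_mul_finrank_invariantTriples binaryOctahedralGroup
  rw [relCount_two_commute, relCount_sq_commute, relCount_cube_eq_cube, relCount_two_sq_eq_sq,
    relCount_cube_eq_sq, card_binaryOctahedralGroup, ← dimAThetaOddGroupAlgebra_eq] at key
  linarith

theorem finrank_invariantPairs_binaryOctahedralGroup :
    finrank ℂ (invariantPairs binaryOctahedralGroup) = 8 := by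
  have key := card_mul_finrank_invariantPairs binaryOctahedralGroup
  rw [relCount_one_commute, relCount_one_sq_eq_sq, card_binaryOctahedralGroup] at key
  linarith

end product

/-- the dimension formulas for `π = (ℤ/mℤ) × O*`, `gcd(m, 6) = 1`; in
particular the values `35` and `27` for `π = O*` itself. -/
theorem dim_aThetaOdd_zmod_prod_binaryOctahedral (m : ℕ) (hm : 1 ≤ m)
    (hcop : Nat.gcd m 6 = 1) :
    (dimAThetaOddGroupAlgebra (Multiplicative (ZMod m) × binaryOctahedralGroup) : ℚ)
      = (34/3) * m^2 + 12 * m + 35/3 ∧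
    (dimAThetaOddKerAug (Multiplicative (ZMod m) × binaryOctahedralGroup) : ℚ)
      = (34/3) * m^2 + 8 * m + 23/3 ∧
    dimAThetaOddGroupAlgebra binaryOctahedralGroup = 35 ∧
    dimAThetaOddKerAug binaryOctahedralGroup = 27 := by
  have : NeZero m := ⟨by omega⟩
  have hA : Nat.card (Multiplicative (ZMod m)) = m := by simp
  have hcop' : (Nat.card (Multiplicative (ZMod m))).Coprime 6 := by rwa [hA]
  have h1 := dimAThetaOddGroupAlgebra_prod_binaryOctahedralGroup _ hcop'
  have h2 := finrank_invariantPairs_prod_binaryOctahedralGroup _ hcop'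
  have h3 := dimAThetaOddKerAug_add (G := Multiplicative (ZMod m) × binaryOctahedralGroup)
  have h4 := dimAThetaOddKerAug_add (G := binaryOctahedralGroup)
  rw [hA] at h1 h2
  rw [h2] at h3
  rw [finrank_invariantPairs_binaryOctahedralGroup,
    dimAThetaOddGroupAlgebra_binaryOctahedralGroup] at h4
  have h1' : (3 : ℚ) * dimAThetaOddGroupAlgebra (Multiplicative (ZMod m) × binaryOctahedralGroup)
      = 34 * m ^ 2 + 36 * m + 35 := by exact_mod_cast h1
  have h3' : (dimAThetaOddKerAug (Multiplicative (ZMod m) × binaryOctahedralGroup) : ℚ)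
      + (4 * m + 4)
      = dimAThetaOddGroupAlgebra (Multiplicative (ZMod m) × binaryOctahedralGroup) := by
    exact_mod_cast h3
  exact ⟨by linarith, by linarith, dimAThetaOddGroupAlgebra_binaryOctahedralGroup, by omega⟩
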